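/- Let N ≥ 2 and let H be an H-matrix satisfying the H-invariance conditions P(N−1,m;H) = (1/N)·C(N,m+1) for m = 1,…,N−1, and suppose λ*_{k,j}(H) = 0 for all j = 1,…,N−2 and k = j+2,…,N. Then Q(N−1,k,j;H) = (j/N)·C(N−j−1,k−1) for all j = 1,…,N−1 and k = 1,…,N−j, and H is the H-matrix of the Optimal Halpern Method: h_{k,k} = k/(k+1) for k = 1,…,N−1 and h_{k,j} = −j/(k(k+1)) for 1 ≤ j < k ≤ N−1. -/

import Mathlib

open Finset

/-- `Pinv H k m` is `P(k,m;H)`: the sum over all index sequences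
`1 ≤ j(1) ≤ i(1) < j(2) ≤ i(2) < ⋯ < j(m) ≤ i(m) ≤ k` of `∏_{r} h_{i(r),j(r)}`,
with `P(k,0;H) = 1`. -/
noncomputable def Pinv (H : ℕ → ℕ → ℝ) (k : ℕ) : ℕ → ℝ
  | 0 => 1
  | m + 1 =>
    ∑ f : Fin (m + 1) → Fin (k + 1) × Fin (k + 1),
      if (∀ r, 1 ≤ ((f r).2 : ℕ) ∧ ((f r).2 : ℕ) ≤ ((f r).1 : ℕ)) ∧
          (∀ r : Fin m, ((f r.castSucc).1 : ℕ) < ((f r.succ).2 : ℕ)) then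
        ∏ r, H ((f r).1 : ℕ) ((f r).2 : ℕ)
      else 0

/-- `Qinv H k m j` is `Q(k,m,j;H)`: the partial sum of `P(k,m;H)` over those index
sequences with `j(1) = j` (zero if no such sequence exists, and zero for `m = 0`). -/
noncomputable def Qinv (H : ℕ → ℕ → ℝ) (k : ℕ) : ℕ → ℕ → ℝ
  | 0, _ => 0
  | m + 1, j =>
    ∑ f : Fin (m + 1) → Fin (k + 1) × Fin (k + 1),
      if (∀ r, 1 ≤ ((f r).2 : ℕ) ∧ ((f r).2 : ℕ) ≤ ((f r).1 : ℕ)) ∧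
          (∀ r : Fin m, ((f r.castSucc).1 : ℕ) < ((f r.succ).2 : ℕ)) ∧
          ((f 0).2 : ℕ) = j then
        ∏ r, H ((f r).1 : ℕ) ((f r).2 : ℕ)
      else 0

/-- The H-certificates `λ*_{k,j}(H)`:
`λ*_{N,j}(H) = N·Σ_{m=1}^{N−j} (−1)^{m−1}·Q(N−1,m,j;H)` for `j = 1,…,N−1`, and
`λ*_{k,j}(H) = N·Σ_{ℓ=1}^{N−j} Σ_{m=1}^{N−k} (−1)^{ℓ+m−1}·C(ℓ+m,m)·Q(N−1,ℓ,j;H)·Q(N−1,m,k;H)`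
for `1 ≤ j < k ≤ N−1`. -/
noncomputable def lamStar (N : ℕ) (H : ℕ → ℕ → ℝ) (k j : ℕ) : ℝ :=
  if k = N then
    (N : ℝ) * ∑ m ∈ Finset.Icc 1 (N - j), (-1 : ℝ) ^ (m - 1) * Qinv H (N - 1) m j
  else
    (N : ℝ) * ∑ l ∈ Finset.Icc 1 (N - j), ∑ m ∈ Finset.Icc 1 (N - k),
      (-1 : ℝ) ^ (l + m - 1) * (Nat.choose (l + m) m : ℝ) *
        Qinv H (N - 1) l j * Qinv H (N - 1) m k

/-- The part of `P(M,m;H)` over index sequences with `j(1) > i`, equal to `1` for `m = 0`. -/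
noncomputable def tailInv (H : ℕ → ℕ → ℝ) (M i : ℕ) : ℕ → ℝ
  | 0 => 1
  | m + 1 => ∑ j ∈ Icc (i + 1) M, Qinv H M (m + 1) j

theorem Fin.sum_prod_eq_sum_range (M : ℕ) (F : ℕ → ℕ → ℝ) :
    ∑ a : Fin (M + 1) × Fin (M + 1), F a.1 a.2 =
      ∑ i ∈ range (M + 1), ∑ j ∈ range (M + 1), F i j := by
  rw [Fintype.sum_prod_type, ← Fin.sum_univ_eq_sum_range (fun i => ∑ j ∈ range (M + 1), F i j)]
  exact Finset.sum_congr rfl fun i _ => Fin.sum_univ_eq_sum_range (fun j => F i j) (M + 1)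

theorem tailInv_succ (H : ℕ → ℕ → ℝ) (M i m : ℕ) :
    tailInv H M i (m + 1) =
      ∑ f : Fin (m + 1) → Fin (M + 1) × Fin (M + 1),
        if (∀ r, 1 ≤ ((f r).2 : ℕ) ∧ ((f r).2 : ℕ) ≤ ((f r).1 : ℕ)) ∧
            (∀ r : Fin m, ((f r.castSucc).1 : ℕ) < ((f r.succ).2 : ℕ)) ∧
            i < ((f 0).2 : ℕ) then
          ∏ r, H ((f r).1 : ℕ) ((f r).2 : ℕ)
        else 0 := by
  simp only [tailInv, Qinv]
  rw [Finset.sum_comm]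
  refine Finset.sum_congr rfl fun f _ => ?_
  have key : ∀ (p : Prop) [Decidable p] (c : ℝ),
      (∑ j ∈ Icc (i + 1) M, if p ∧ ((f 0).2 : ℕ) = j then c else 0) =
        if p ∧ i < ((f 0).2 : ℕ) then c else 0 := by
    intro p _ c
    have h2 : ((f 0).2 : ℕ) ≤ M := Nat.le_of_lt_succ (f 0).2.isLt
    by_cases hp : p <;> simp [hp, h2]
  simp only [← and_assoc, key]

theorem Pinv_succ_eq_tailInv (H : ℕ → ℕ → ℝ) (M m : ℕ) :
    Pinv H M (m + 1) = tailInv H M 0 (m + 1) := by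
  rw [tailInv_succ, Pinv]
  refine Finset.sum_congr rfl fun f _ => ?_
  refine if_congr ?_ rfl rfl
  exact ⟨fun h => ⟨h.1, h.2, (h.1 0).1⟩, fun h => ⟨h.1, h.2.1⟩⟩

theorem Qinv_succ (H : ℕ → ℕ → ℝ) (M m j : ℕ) (hj : 1 ≤ j) :
    Qinv H M (m + 1) j = ∑ i ∈ Icc j M, H i j * tailInv H M i m := by
  have key : Qinv H M (m + 1) j = ∑ a : Fin (M + 1) × Fin (M + 1),
      if (a.2 : ℕ) = j ∧ j ≤ (a.1 : ℕ) then H a.1 j * tailInv H M a.1 m else 0 := by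
    rw [Qinv, ← (Fin.consEquiv fun _ => Fin (M + 1) × Fin (M + 1)).sum_comp,
      Fintype.sum_prod_type]
    refine Finset.sum_congr rfl fun a _ => ?_
    simp only [Fin.consEquiv_apply, Fin.cons_zero]
    by_cases ha : (a.2 : ℕ) = j ∧ j ≤ (a.1 : ℕ)
    · obtain ⟨ha1, ha2⟩ := ha
      cases m with
      | zero => simp [tailInv, ha1, ha2, hj, -Fin.val_fin_le, -Fin.val_fin_lt]
      | succ m =>
        rw [tailInv_succ, if_pos ⟨ha1, ha2⟩, Finset.mul_sum]
        refine Finset.sum_congr rfl fun g _ => ?_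
        rw [mul_ite, mul_zero, Fin.prod_univ_succ]
        refine if_congr ?_ (by simp [ha1]) rfl
        have hlt : (∀ r : Fin (m + 1), ((Fin.cons (α := fun _ => Fin (M + 1) × Fin (M + 1)) a g
            r.castSucc).1 : ℕ) < ((Fin.cons (α := fun _ => Fin (M + 1) × Fin (M + 1)) a g
            r.succ).2 : ℕ)) ↔ (a.1 : ℕ) < ((g 0).2 : ℕ) ∧
              ∀ r : Fin m, ((g r.castSucc).1 : ℕ) < ((g r.succ).2 : ℕ) := by
          rw [Fin.forall_fin_succ]
          simp only [Fin.cons_succ, Fin.castSucc_zero, Fin.cons_zero, Fin.castSucc_succ]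
        rw [hlt, Fin.forall_fin_succ]
        simp only [Fin.cons_zero, Fin.cons_succ, ha1]
        tauto
    · rw [if_neg ha]
      refine Finset.sum_eq_zero fun g _ => if_neg ?_
      rintro ⟨h1, -, h3⟩
      have := (h1 0).2
      simp only [Fin.cons_zero] at this
      exact ha ⟨h3, h3 ▸ this⟩
  rw [key, Fin.sum_prod_eq_sum_range M
    (fun i l => if l = j ∧ j ≤ i then H i j * tailInv H M i m else 0)]
  have h1 : ∀ i ∈ range (M + 1),
      (∑ l ∈ range (M + 1), if l = j ∧ j ≤ i then H i j * tailInv H M i m else 0) =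
        if j ≤ i then H i j * tailInv H M i m else 0 := by
    intro i hi
    rw [Finset.mem_range] at hi
    by_cases h : j ≤ i
    · simp only [h, and_true, if_true, Finset.sum_ite_eq', Finset.mem_range]
      exact if_pos (by omega)
    · simp [h]
  rw [Finset.sum_congr rfl h1, ← Finset.sum_filter]
  refine Finset.sum_congr ?_ fun _ _ => rfl
  ext i
  simp only [Finset.mem_filter, Finset.mem_range, Finset.mem_Icc]
  omega

theorem Qinv_eq_zero (H : ℕ → ℕ → ℝ) (M m j : ℕ) (hj : 1 ≤ j) (h : M + 1 < m + j) :
    Qinv H M m j = 0 := by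
  induction m generalizing j with
  | zero => rfl
  | succ m ih =>
    rw [Qinv_succ H M m j hj]
    refine Finset.sum_eq_zero fun i hi => ?_
    rw [Finset.mem_Icc] at hi
    cases m with
    | zero => omega
    | succ m =>
      rw [tailInv, Finset.sum_eq_zero, mul_zero]
      intro l hl
      rw [Finset.mem_Icc] at hl
      exact ih l (by omega) (by omega)

theorem tailInv_eq_zero (H : ℕ → ℕ → ℝ) (M m i : ℕ) (hm : 1 ≤ m) (h : M < m + i) :
    tailInv H M i m = 0 := by
  obtain ⟨m, rfl⟩ := Nat.exists_eq_add_of_le' hm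
  refine Finset.sum_eq_zero fun l hl => ?_
  rw [Finset.mem_Icc] at hl
  exact Qinv_eq_zero H M _ l (by omega) (by omega)

theorem tailInv_succ_sub (H : ℕ → ℕ → ℝ) (M m i : ℕ) (hi : i < M) :
    tailInv H M i (m + 1) = Qinv H M (m + 1) (i + 1) + tailInv H M (i + 1) (m + 1) := by
  simp only [tailInv]
  rw [← Finset.add_sum_Ioc_eq_sum_Icc (by omega : i + 1 ≤ M), Finset.Icc_add_one_left_eq_Ioc]

theorem Qinv_top (H : ℕ → ℕ → ℝ) (M j : ℕ) (hj : 1 ≤ j) (hjM : j < M) :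
    Qinv H M (M + 1 - j) j = H j j * Qinv H M (M - j) (j + 1) := by
  obtain ⟨d, rfl⟩ : ∃ d, M = j + (d + 1) := ⟨M - j - 1, by omega⟩
  rw [show j + (d + 1) + 1 - j = (d + 1) + 1 by omega, Qinv_succ _ _ _ _ hj,
    Finset.sum_eq_single j, tailInv_succ_sub _ _ _ _ (by omega),
    tailInv_eq_zero _ _ _ _ (by omega) (by omega), add_zero,
    show j + (d + 1) - j = d + 1 by omega]
  · intro i hi hij
    rw [Finset.mem_Icc] at hi
    rw [tailInv_eq_zero _ _ _ _ (by omega) (by omega), mul_zero]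
  · intro h
    exact absurd (Finset.mem_Icc.2 ⟨le_rfl, by omega⟩) h

theorem Qinv_top_ne_zero (H : ℕ → ℕ → ℝ) (M : ℕ) (hM : Qinv H M M 1 ≠ 0) (j : ℕ)
    (hj : 1 ≤ j) (hjM : j ≤ M) : Qinv H M (M + 1 - j) j ≠ 0 := by
  induction j, hj using Nat.le_induction with
  | base => simpa using hM
  | succ j hj ih =>
    have h := ih (by omega)
    rw [Qinv_top H M j hj (by omega)] at h
    rw [Nat.add_sub_add_right]
    exact right_ne_zero_of_mul h

/-- A homogeneous linear system that is triangular along the antidiagonal has only the zero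
solution. -/
theorem eq_zero_of_antitriangular (M j : ℕ) (R : ℕ → ℕ → ℝ) (h : ℕ → ℝ)
    (hzero : ∀ i m, i ≤ M → M < m + i → R i m = 0)
    (hdiag : ∀ i, j ≤ i → i ≤ M → R i (M - i) ≠ 0)
    (hsum : ∀ m, m ≤ M - j → ∑ i ∈ Icc j M, h i * R i m = 0) (i : ℕ) (hji : j ≤ i)
    (hi : i ≤ M) : h i = 0 := by
  induction i using Nat.strong_induction_on with
  | _ i ih =>
    have hs := hsum (M - i) (by omega)
    rw [Finset.sum_eq_single i] at hs
    · exact (mul_eq_zero.1 hs).resolve_right (hdiag i hji hi)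
    · intro l hl hne
      rw [Finset.mem_Icc] at hl
      rcases lt_or_gt_of_ne hne with hlt | hlt
      · rw [ih l hlt hl.1 hl.2, zero_mul]
      · rw [hzero l _ hl.2 (by omega), mul_zero]
    · intro hn
      exact absurd (Finset.mem_Icc.2 ⟨hji, hi⟩) hn

theorem sum_mul_choose_sub (M m : ℕ) :
    ∑ j ∈ Icc 1 M, j * (M - j).choose m = (M + 1).choose (m + 2) := by
  have hockey : ∀ M : ℕ, ∑ j ∈ Icc 1 M, (M - j).choose m = M.choose (m + 1) := by
    intro M
    induction M with
    | zero => simp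
    | succ M ih =>
      rw [← Finset.add_sum_Ioc_eq_sum_Icc (by omega : 1 ≤ M + 1), Nat.choose_succ_succ, ← ih]
      congr 1
      refine (Finset.sum_bij (fun j _ => j + 1) ?_ ?_ ?_ ?_).symm
      · intro a ha; simp at ha ⊢; omega
      · intro a _ b _ h; omega
      · intro b hb
        simp at hb
        exact ⟨b - 1, by simp; omega, by omega⟩
      · intro a _; rw [Nat.add_sub_add_right]
  induction M with
  | zero => simp [Nat.choose_eq_zero_of_lt]
  | succ M ih =>
    have h : ∑ j ∈ Icc 1 (M + 1), j * (M + 1 - j).choose m =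
        ∑ j ∈ Icc 1 (M + 1), (M + 1 - j).choose m + ∑ j ∈ Icc 1 M, j * (M - j).choose m := by
      rw [← Finset.add_sum_Ioc_eq_sum_Icc (by omega : 1 ≤ M + 1),
        ← Finset.add_sum_Ioc_eq_sum_Icc (by omega : 1 ≤ M + 1), one_mul, add_assoc]
      congr 1
      have : ∀ F : ℕ → ℕ, ∑ j ∈ Ioc 1 (M + 1), F j = ∑ j ∈ Icc 1 M, F (j + 1) := by
        intro F
        refine (Finset.sum_bij (fun j _ => j + 1) ?_ ?_ ?_ ?_).symm
        · intro a ha; simp at ha ⊢; omega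
        · intro a _ b _ h; omega
        · intro b hb
          simp at hb
          exact ⟨b - 1, by simp; omega, by omega⟩
        · intro a _; rfl
      rw [this, this, ← Finset.sum_add_distrib]
      refine Finset.sum_congr rfl fun j _ => ?_
      rw [Nat.add_sub_add_right]
      ring
    rw [h, hockey, ih, ← Nat.choose_succ_succ]

open Polynomial in
theorem coeff_taylor_sum (a : ℕ → ℝ) (r : ℝ) (p i : ℕ) :
    (taylor r (∑ l ∈ range p, C (a l) * X ^ l)).coeff i =
      ∑ l ∈ range p, a l * (r ^ (l - i) * (l.choose i : ℝ)) := by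
  simp only [map_sum, taylor_mul, taylor_C, taylor_X_pow, finsetSum_coeff, coeff_C_mul,
    coeff_X_add_C_pow]

theorem sum_neg_one_pow_mul_choose (l m K : ℕ) (hm : m < K) :
    ∑ i ∈ range K, ((-1 : ℝ) ^ (l - i) * (l.choose i : ℝ)) *
      ((-1 : ℝ) ^ (m - i) * (m.choose i : ℝ)) = (-1) ^ (l + m) * ((l + m).choose m : ℝ) := by
  rw [Nat.add_choose_eq, Finset.Nat.sum_antidiagonal_eq_sum_range_succ_mk, Nat.cast_sum,
    Finset.mul_sum]
  symm
  refine Finset.sum_subset_zero_on_sdiff (Finset.range_subset_range.2 hm) ?_ ?_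
  · intro i hi
    simp only [Finset.mem_sdiff, Finset.mem_range] at hi
    rw [Nat.choose_eq_zero_of_lt (by omega : m < i)]
    simp
  · intro i hi
    rw [Finset.mem_range] at hi
    have him : i ≤ m := by omega
    push_cast
    rw [Nat.choose_symm him]
    rcases lt_or_ge l i with h | h
    · simp [Nat.choose_eq_zero_of_lt h]
    · have : (-1 : ℝ) ^ (l + m) = (-1) ^ (l - i) * (-1) ^ (m - i) := by
        rw [← pow_add, show l + m = (l - i + (m - i)) + 2 * i by omega, pow_add, pow_mul]
        simp
      rw [this]
      ring

open Polynomial in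
theorem sum_coeff_taylor_mul_coeff_taylor (a b : ℕ → ℝ) (p q : ℕ) :
    ∑ i ∈ range q, (taylor (-1) (∑ l ∈ range p, C (a l) * X ^ l)).coeff i *
      (taylor (-1) (∑ m ∈ range q, C (b m) * X ^ m)).coeff i =
    ∑ l ∈ range p, ∑ m ∈ range q, (-1) ^ (l + m) * ((l + m).choose m : ℝ) * a l * b m := by
  simp only [coeff_taylor_sum, Finset.sum_mul_sum]
  rw [Finset.sum_comm]
  refine Finset.sum_congr rfl fun l _ => ?_
  rw [Finset.sum_comm]
  refine Finset.sum_congr rfl fun m hm => ?_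
  rw [← sum_neg_one_pow_mul_choose l m q (Finset.mem_range.1 hm), Finset.sum_mul, Finset.sum_mul]
  exact Finset.sum_congr rfl fun i _ => by ring

open Polynomial in
/-- A graded family of polynomials vanishing at `0` in positive degree, whose expansions at `-1`
are orthogonal for index gaps of at least two, consists of multiples of `X * (X + 1) ^ (n - 1)`. -/
theorem eq_C_mul_of_orthogonal (M : ℕ) (f : ℕ → ℝ[X])
    (hdeg : ∀ n ≤ M, (f n).natDegree ≤ n) (hlead : ∀ n ≤ M, (f n).coeff n ≠ 0)
    (hcoeff : ∀ n, 1 ≤ n → n ≤ M → (f n).coeff 0 = 0)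
    (horth : ∀ b n, b + 2 ≤ n → n ≤ M →
      ∑ i ∈ range (b + 1), (taylor (-1) (f n)).coeff i * (taylor (-1) (f b)).coeff i = 0)
    (n : ℕ) (hn : 1 ≤ n) (hnM : n ≤ M) :
    f n = C ((f n).coeff n) * ((X + 1) ^ (n - 1) * X) := by
  have hnat : ∀ n ≤ M, (f n).natDegree = n := fun n h =>
    le_antisymm (hdeg n h) (le_natDegree_of_ne_zero (hlead n h))
  have htop : ∀ n ≤ M, (taylor (-1) (f n)).coeff n = (f n).coeff n := by
    intro n h
    have := coeff_taylor_natDegree (-1 : ℝ) (f n)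
    rwa [leadingCoeff, hnat n h] at this
  have hlow : ∀ b, b + 2 ≤ n → (taylor (-1) (f n)).coeff b = 0 := by
    intro b
    induction b using Nat.strong_induction_on with
    | _ b ih =>
      intro hb
      have h := horth b n hb hnM
      rw [Finset.sum_range_succ, Finset.sum_eq_zero, zero_add, htop b (by omega)] at h
      · exact (mul_eq_zero.1 h).resolve_right (hlead b (by omega))
      · intro i hi
        rw [Finset.mem_range] at hi
        rw [ih i hi (by omega), zero_mul]
  obtain ⟨k, rfl⟩ := Nat.exists_eq_add_of_le' hn
  have hform : taylor (-1) (f (k + 1)) = C ((f (k + 1)).coeff (k + 1)) * X ^ (k + 1) +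
      C ((taylor (-1) (f (k + 1))).coeff k) * X ^ k := by
    ext i
    rw [coeff_add, coeff_C_mul_X_pow, coeff_C_mul_X_pow]
    rcases lt_trichotomy i k with h | h | h
    · rw [hlow i (by omega), if_neg (by omega), if_neg (by omega), add_zero]
    · subst h
      simp
    · rcases (by omega : i = k + 1 ∨ k + 1 < i) with rfl | h
      · rw [htop _ hnM]
        simp
      · rw [if_neg (by omega), if_neg (by omega), add_zero]
        exact coeff_eq_zero_of_natDegree_lt (by rw [natDegree_taylor, hnat _ hnM]; exact h)
  have heval := congrArg (eval 1) hform
  rw [taylor_eval, add_neg_cancel, ← coeff_zero_eq_eval_zero, hcoeff _ hn hnM] at heval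
  simp only [eval_add, eval_mul, eval_C, eval_pow, eval_X, one_pow, mul_one] at heval
  rw [eq_neg_of_add_eq_zero_right heval.symm] at hform
  have hinv := congrArg (taylor 1) hform
  rw [taylor_taylor, add_neg_cancel, taylor_zero] at hinv
  conv_lhs => rw [hinv]
  simp only [map_add, taylor_mul, taylor_C, taylor_X_pow, map_neg, map_one, Nat.add_sub_cancel]
  ring

/-- The entries of the H-matrix of the Optimal Halpern Method. -/
noncomputable def ohmEntry (k j : ℕ) : ℝ :=
  if k = j then (k : ℝ) / (k + 1) else -((j : ℝ) / ((k : ℝ) * (k + 1)))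

theorem sum_ohmEntry_mul (M : ℕ) (r g : ℕ → ℝ) (hM : r M = g M)
    (hr : ∀ i < M, r i = r (i + 1) + (i + 1) / (M + 1) * (g i - g (i + 1))) (j : ℕ)
    (hjM : j ≤ M) : ∑ i ∈ Icc j M, ohmEntry i j * r i = j / (M + 1) * g j := by
  have key : ∀ d j, j + d = M →
      r j / (j + 1) - ∑ i ∈ Ioc j M, r i / ((i : ℝ) * (i + 1)) = g j / (M + 1) := by
    intro d
    induction d with
    | zero =>
      rintro j rfl
      rw [add_zero] at hM
      simp [hM]
    | succ d ih =>
      intro j hjd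
      have h := ih (j + 1) (by omega)
      rw [← Finset.Icc_add_one_left_eq_Ioc, ← Finset.add_sum_Ioc_eq_sum_Icc (by omega : j + 1 ≤ M),
        hr j (by omega)]
      have h2 : (∑ i ∈ Ioc (j + 1) M, r i / ((i : ℝ) * (i + 1))) =
          r (j + 1) / (((j + 1 : ℕ) : ℝ) + 1) - g (j + 1) / (M + 1) := by linarith
      rw [h2]
      push_cast
      have h3 : (j : ℝ) + 1 ≠ 0 := by positivity
      have h4 : (j : ℝ) + 1 + 1 ≠ 0 := by positivity
      have h5 : (M : ℝ) + 1 ≠ 0 := by positivity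
      field_simp
      ring
  rw [← Finset.add_sum_Ioc_eq_sum_Icc hjM, div_mul_eq_mul_div, mul_div_assoc,
    ← key (M - j) j (by omega), mul_sub, Finset.mul_sum, sub_eq_add_neg, ← Finset.sum_neg_distrib]
  congr 1
  · rw [ohmEntry, if_pos rfl]
    ring
  · refine Finset.sum_congr rfl fun i hi => ?_
    rw [Finset.mem_Ioc] at hi
    rw [ohmEntry, if_neg (by omega)]
    ring

/-- The coefficients of the generating polynomial of `Q(M,·,M+1-n;H)`, with the constant
polynomial `1` for `n = 0`. -/
noncomputable def certCoeff (H : ℕ → ℕ → ℝ) (M n l : ℕ) : ℝ :=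
  if n = 0 then (if l = 0 then 1 else 0) else Qinv H M l (M + 1 - n)

theorem sum_certCoeff_eq_zero (M : ℕ) (H : ℕ → ℕ → ℝ)
    (hsparse : ∀ j k, 1 ≤ j → j ≤ M - 1 → j + 2 ≤ k → k ≤ M + 1 → lamStar (M + 1) H k j = 0)
    (b n : ℕ) (hbn : b + 2 ≤ n) (hn : n ≤ M) :
    ∑ l ∈ range (n + 1), ∑ m ∈ range (b + 1), (-1) ^ (l + m) * ((l + m).choose m : ℝ) *
      certCoeff H M n l * certCoeff H M b m = 0 := by
  have hn0 : n ≠ 0 := by omega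
  have hrange : ∀ (n : ℕ) (F : ℕ → ℝ), F 0 = 0 →
      ∑ l ∈ range (n + 1), F l = ∑ l ∈ Icc 1 n, F l := by
    intro n F hF
    symm
    refine Finset.sum_subset (fun i hi => ?_) fun i hi hi' => ?_
    · simp only [Finset.mem_Icc, Finset.mem_range] at hi ⊢
      omega
    · simp only [Finset.mem_Icc, Finset.mem_range] at hi hi'
      rw [(by omega : i = 0), hF]
  have h := hsparse (M + 1 - n) (M + 1 - b) (by omega) (by omega) (by omega) (by omega)
  rw [lamStar, show M + 1 - (M + 1 - n) = n by omega, show M + 1 - (M + 1 - b) = b by omega,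
    Nat.add_sub_cancel] at h
  rw [hrange _ _ (by simp [certCoeff, hn0, Qinv]), ← neg_eq_zero, ← Finset.sum_neg_distrib]
  rcases Nat.eq_zero_or_pos b with rfl | hb
  · rw [if_pos (by omega)] at h
    refine Eq.trans ?_ ((mul_eq_zero.1 h).resolve_left (by positivity))
    refine Finset.sum_congr rfl fun l hl => ?_
    obtain ⟨l, rfl⟩ := Nat.exists_eq_add_of_le' (Finset.mem_Icc.1 hl).1
    simp [certCoeff, hn0, pow_succ]
  · rw [if_neg (by omega)] at h
    refine Eq.trans ?_ ((mul_eq_zero.1 h).resolve_left (by positivity))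
    refine Finset.sum_congr rfl fun l hl => ?_
    obtain ⟨l, rfl⟩ := Nat.exists_eq_add_of_le' (Finset.mem_Icc.1 hl).1
    rw [hrange _ _ (by simp [certCoeff, hb.ne', Qinv]), ← Finset.sum_neg_distrib]
    refine Finset.sum_congr rfl fun m _ => ?_
    rw [certCoeff, certCoeff, if_neg hn0, if_neg hb.ne', show l + 1 + m = l + m + 1 by omega,
      Nat.add_sub_cancel, pow_succ]
    ring

open Polynomial in
theorem Qinv_eq_mul_choose (M : ℕ) (H : ℕ → ℕ → ℝ) (htop : Qinv H M M 1 ≠ 0)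
    (hsparse : ∀ j k, 1 ≤ j → j ≤ M - 1 → j + 2 ≤ k → k ≤ M + 1 → lamStar (M + 1) H k j = 0)
    (j m : ℕ) (hj : 1 ≤ j) (hjM : j ≤ M) :
    Qinv H M (m + 1) j = Qinv H M (M + 1 - j) j * ((M - j).choose m : ℝ) := by
  set f : ℕ → ℝ[X] := fun n => ∑ l ∈ range (n + 1), C (certCoeff H M n l) * X ^ l with hf
  have hcoeff : ∀ n l, l ≤ n → (f n).coeff l = certCoeff H M n l := by
    intro n l hl
    simp only [hf, finsetSum_coeff, coeff_C_mul_X_pow, Finset.sum_ite_eq, Finset.mem_range]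
    rw [if_pos (by omega)]
  have hdeg : ∀ n, (f n).natDegree ≤ n := by
    intro n
    refine natDegree_sum_le_of_forall_le _ _ fun l hl => ?_
    exact (natDegree_C_mul_X_pow_le _ _).trans (by rw [Finset.mem_range] at hl; omega)
  have hzero : ∀ n l, 1 ≤ n → certCoeff H M n l = Qinv H M l (M + 1 - n) := by
    intro n l hn
    rw [certCoeff, if_neg (by omega)]
  have hform := eq_C_mul_of_orthogonal M f (fun n _ => hdeg n) ?_ ?_ ?_ (M + 1 - j) (by omega)
    (by omega)
  · rcases lt_or_ge (M - j) m with h | h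
    · rw [Nat.choose_eq_zero_of_lt h, Qinv_eq_zero _ _ _ _ hj (by omega)]
      simp
    · have h2 := congrArg (fun p => coeff p (m + 1)) hform
      simp only [coeff_C_mul, coeff_mul_X, coeff_X_add_one_pow] at h2
      rw [hcoeff _ _ (by omega), hcoeff _ _ le_rfl, hzero _ _ (by omega), hzero _ _ (by omega),
        show M + 1 - (M + 1 - j) = j by omega, show M + 1 - j - 1 = M - j by omega] at h2
      exact h2
  · intro n hn
    rw [hcoeff _ _ le_rfl]
    rcases Nat.eq_zero_or_pos n with rfl | hn0
    · simp [certCoeff]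
    · rw [hzero _ _ hn0]
      have := Qinv_top_ne_zero H M htop (M + 1 - n) (by omega) (by omega)
      rwa [show M + 1 - (M + 1 - n) = n by omega] at this
  · intro n hn _
    rw [hcoeff _ _ (Nat.zero_le n), hzero _ _ hn, Qinv]
  · intro b n hbn hn
    simp only [hf]
    rw [sum_coeff_taylor_mul_coeff_taylor]
    exact sum_certCoeff_eq_zero M H hsparse b n hbn hn

theorem Qinv_eq_of_sparse (M : ℕ) (H : ℕ → ℕ → ℝ) (hM : 1 ≤ M)
    (hinv : ∀ m, 1 ≤ m → m ≤ M →
      Pinv H M m = 1 / ((M + 1 : ℕ) : ℝ) * ((M + 1).choose (m + 1) : ℝ))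
    (hsparse : ∀ j k, 1 ≤ j → j ≤ M - 1 → j + 2 ≤ k → k ≤ M + 1 → lamStar (M + 1) H k j = 0)
    (j m : ℕ) (hj : 1 ≤ j) (hjM : j ≤ M) :
    Qinv H M (m + 1) j = (j : ℝ) / (M + 1) * ((M - j).choose m : ℝ) := by
  have hsum : ∀ m, m + 1 ≤ M → ∑ j ∈ Icc 1 M, Qinv H M (m + 1) j =
      1 / (M + 1) * ((M + 1).choose (m + 2) : ℝ) := by
    intro m hm
    have h := hinv (m + 1) (by omega) hm
    rw [Pinv_succ_eq_tailInv, tailInv] at h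
    simpa using h
  have htop : Qinv H M M 1 ≠ 0 := by
    obtain ⟨d, rfl⟩ := Nat.exists_eq_add_of_le' hM
    have h := hsum d le_rfl
    rw [Finset.sum_eq_single 1] at h
    · rw [h, Nat.choose_self]
      positivity
    · intro i hi hne
      rw [Finset.mem_Icc] at hi
      exact Qinv_eq_zero _ _ _ _ hi.1 (by omega)
    · intro hn
      exact absurd (Finset.mem_Icc.2 ⟨le_rfl, by omega⟩) hn
  have hform := Qinv_eq_mul_choose M H htop hsparse
  have hlead := eq_zero_of_antitriangular M 1 (fun i m => ((M - i).choose m : ℝ))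
    (fun i => Qinv H M (M + 1 - i) i - (i : ℝ) / (M + 1)) ?_ ?_ ?_ j hj hjM
  · rw [hform j m hj hjM, sub_eq_zero.1 hlead]
  · intro i m _ h
    rw [Nat.choose_eq_zero_of_lt (by omega), Nat.cast_zero]
  · intro i _ _
    simp
  · intro m hm
    have h1 := hsum m (by omega)
    rw [← sum_mul_choose_sub M m, Finset.sum_congr rfl fun i hi =>
      hform i m (Finset.mem_Icc.1 hi).1 (Finset.mem_Icc.1 hi).2] at h1
    simp only [sub_mul, Finset.sum_sub_distrib]
    rw [h1, sub_eq_zero, Nat.cast_sum, Finset.mul_sum]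
    refine Finset.sum_congr rfl fun i _ => ?_
    push_cast
    ring

theorem eq_ohmEntry_of_Qinv_eq (M : ℕ) (H : ℕ → ℕ → ℝ)
    (hQ : ∀ j m, 1 ≤ j → j ≤ M →
      Qinv H M (m + 1) j = (j : ℝ) / (M + 1) * ((M - j).choose m : ℝ))
    (j i : ℕ) (hj : 1 ≤ j) (hji : j ≤ i) (hi : i ≤ M) : H i j = ohmEntry i j := by
  refine sub_eq_zero.1 (eq_zero_of_antitriangular M j (tailInv H M)
    (fun i => H i j - ohmEntry i j) ?_ ?_ ?_ i hji hi)
  · intro i m hi h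
    exact tailInv_eq_zero _ _ _ _ (by omega) h
  · intro i hji hi
    rcases hi.eq_or_lt with rfl | hlt
    · simp [tailInv]
    · obtain ⟨d, rfl⟩ : ∃ d, M = i + (d + 1) := ⟨M - i - 1, by omega⟩
      rw [show i + (d + 1) - i = d + 1 by omega, tailInv_succ_sub _ _ _ _ hlt,
        tailInv_eq_zero _ _ _ _ (by omega) (by omega), hQ _ _ (by omega) (by omega),
        show i + (d + 1) - (i + 1) = d by omega, Nat.choose_self]
      positivity
  · intro m _
    simp only [sub_mul, Finset.sum_sub_distrib]
    rw [← Qinv_succ H M m j hj, hQ j m hj (by omega), sub_eq_zero]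
    refine (sum_ohmEntry_mul M (fun i => tailInv H M i m) (fun i => ((M - i).choose m : ℝ))
      ?_ ?_ j (by omega)).symm
    · cases m <;> simp [tailInv]
    · intro i hi
      cases m with
      | zero => simp [tailInv]
      | succ m =>
        rw [tailInv_succ_sub _ _ _ _ hi, hQ _ _ (by omega) (by omega),
          show M - i = M - (i + 1) + 1 by omega, Nat.choose_succ_succ]
        push_cast
        ring

/-- **OHM is the unique optimal H-matrix with the top-sparsity pattern (Props 8.2, 8.3).**
If `H` satisfies H-invariance and `λ*_{k,j}(H) = 0` for all `j = 1,…,N−2` and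
`k = j+2,…,N`, then `Q(N−1,k,j;H) = (j/N)·C(N−j−1,k−1)` for all admissible `j,k`, and `H`
is the H-matrix of OHM: `h_{k,k} = k/(k+1)` and `h_{k,j} = −j/(k(k+1))` for `j < k`. -/
theorem ohm_from_top_sparsity (N : ℕ) (hN : 2 ≤ N) (H : ℕ → ℕ → ℝ)
    (hinv : ∀ m, 1 ≤ m → m ≤ N - 1 →
      Pinv H (N - 1) m = 1 / (N : ℝ) * (Nat.choose N (m + 1) : ℝ))
    (hsparse : ∀ j k, 1 ≤ j → j ≤ N - 2 → j + 2 ≤ k → k ≤ N → lamStar N H k j = 0) :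
    (∀ j k, 1 ≤ j → j ≤ N - 1 → 1 ≤ k → k ≤ N - j →
      Qinv H (N - 1) k j = (j : ℝ) / (N : ℝ) * (Nat.choose (N - j - 1) (k - 1) : ℝ)) ∧
    (∀ k, 1 ≤ k → k ≤ N - 1 → H k k = (k : ℝ) / ((k : ℝ) + 1)) ∧
    (∀ k j, 1 ≤ j → j < k → k ≤ N - 1 →
      H k j = -((j : ℝ) / ((k : ℝ) * ((k : ℝ) + 1)))) := by
  obtain ⟨M, rfl⟩ : ∃ M, N = M + 1 := ⟨N - 1, by omega⟩
  have hQ := Qinv_eq_of_sparse M H (by omega) hinv hsparse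
  have hH := eq_ohmEntry_of_Qinv_eq M H hQ
  simp only [Nat.add_sub_cancel]
  refine ⟨fun j k hj hjM hk hkM => ?_, fun k hk hkM => ?_, fun k j hj hjk hkM => ?_⟩
  · obtain ⟨m, rfl⟩ := Nat.exists_eq_add_of_le' hk
    rw [hQ j m hj hjM, show M + 1 - j - 1 = M - j by omega, Nat.add_sub_cancel]
    push_cast
    rfl
  · rw [hH k k hk le_rfl hkM, ohmEntry, if_pos rfl]
  · rw [hH j k hj hjk.le hkM, ohmEntry, if_neg (by omega)]
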